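/- arXiv:math/0305370 — 4 statements merged into one kernel-verified Lean document; each statement's English description precedes it below -/
import Mathlib

section
/- Let (Λ,d) be a finitely aligned k-graph and let {t_λ : λ ∈ Λ} be a family of partial isometries in a C*-algebra satisfying relations (CK1)–(CK3). Then for every n ∈ ℕ^k and all λ,μ ∈ Λ^{≤n}, one has t_λ* t_μ = δ_{λ,μ} t_{s(λ)}. -/
open scoped BigOperators

/-- A `k`-graph: a countable small category (in arrows-only presentation, with objects
identified with the identity morphisms) together with a degree functor into `ℕ^k`
satisfying the factorisation property.  `comp l m` is the composite path `lm`
(first `m`, then `l` in categorical order; range `rng l`, source `src m`), and is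
only meaningful when `src l = rng m`. -/
structure KGraph (k : ℕ) where
  Path : Type
  countable : Countable Path
  src : Path → Path
  rng : Path → Path
  comp : Path → Path → Path
  deg : Path → Fin k → ℕ
  deg_src : ∀ l, deg (src l) = 0
  deg_rng : ∀ l, deg (rng l) = 0
  src_eq_of_deg_zero : ∀ v, deg v = 0 → src v = v
  rng_eq_of_deg_zero : ∀ v, deg v = 0 → rng v = v
  comp_src_self : ∀ l, comp l (src l) = l
  rng_comp_self : ∀ l, comp (rng l) l = l
  src_comp : ∀ l m, src l = rng m → src (comp l m) = src m
  rng_comp : ∀ l m, src l = rng m → rng (comp l m) = rng l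
  deg_comp : ∀ l m, src l = rng m → deg (comp l m) = deg l + deg m
  comp_assoc : ∀ l m n, src l = rng m → src m = rng n →
    comp (comp l m) n = comp l (comp m n)
  factorisation : ∀ (l : Path) (m n : Fin k → ℕ), deg l = m + n →
    ∃! p : Path × Path, deg p.1 = m ∧ deg p.2 = n ∧ src p.1 = rng p.2 ∧
      comp p.1 p.2 = l

namespace KGraph

variable {k : ℕ} (Λ : KGraph k)

/-- The vertices of a `k`-graph are the paths of degree `0`. -/
def IsVertex (v : Λ.Path) : Prop := Λ.deg v = 0

/-- An edge is a path of degree `e_i` for some `i`. -/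
def IsEdge (e : Λ.Path) : Prop := ∃ i : Fin k, Λ.deg e = Pi.single i 1

/-- `vΛ`, the set of paths with range `v`. -/
def withRange (v : Λ.Path) : Set Λ.Path := {l | Λ.rng l = v}

/-- `Λ^min(l,m)`, the set of pairs giving minimal common extensions of `l` and `m`. -/
def minExt (l m : Λ.Path) : Set (Λ.Path × Λ.Path) :=
  {p | Λ.src l = Λ.rng p.1 ∧ Λ.src m = Λ.rng p.2 ∧
    Λ.comp l p.1 = Λ.comp m p.2 ∧ Λ.deg (Λ.comp l p.1) = Λ.deg l ⊔ Λ.deg m}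

/-- A `k`-graph is finitely aligned if all the sets `Λ^min(l,m)` are finite. -/
def FinitelyAligned : Prop := ∀ l m, (Λ.minExt l m).Finite

/-- A subset `E ⊆ vΛ` is exhaustive if every path in `vΛ` has a common extension
with some member of `E`. -/
def Exhaustive (v : Λ.Path) (E : Set Λ.Path) : Prop :=
  ∀ m ∈ Λ.withRange v, ∃ l ∈ E, (Λ.minExt l m).Nonempty

/-- `Λ^{≤ n}`. -/
def degLe (n : Fin k → ℕ) : Set Λ.Path :=
  {l | Λ.deg l ≤ n ∧ ∀ i : Fin k, Λ.deg l i < n i →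
    ¬∃ e, Λ.rng e = Λ.src l ∧ Λ.deg e = Pi.single i 1}

end KGraph

open Classical in
/-- The sum of `f` over a set `S`, defined to be `0` if `S` is infinite. -/
noncomputable def setSum {ι A : Type*} [AddCommMonoid A] (S : Set ι) (f : ι → A) : A :=
  if h : S.Finite then ∑ i ∈ h.toFinset, f i else 0

open Classical in
/-- The product of `f` over a set `S` taken in an arbitrary (but fixed) order,
defined to be `1` if `S` is infinite.  All products appearing below have commuting
factors, for which this is the usual product over a finite set. -/
noncomputable def setProd {ι A : Type*} [Monoid A] (S : Set ι) (f : ι → A) : A :=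
  if h : S.Finite then (h.toFinset.toList.map f).prod else 1

namespace KGraph

variable {k : ℕ} (Λ : KGraph k) {A : Type*} [Ring A] [StarRing A]

/-- Relations (CK1)–(CK3) for a family of partial isometries indexed by a `k`-graph. -/
structure IsCK13 (t : Λ.Path → A) : Prop where
  partialIsometry : ∀ l, t l * star (t l) * t l = t l
  vertex_projection : ∀ v, Λ.IsVertex v → star (t v) = t v ∧ t v * t v = t v
  vertex_orthogonal : ∀ v w, Λ.IsVertex v → Λ.IsVertex w → v ≠ w → t v * t w = 0
  comp_mul : ∀ l m, Λ.src l = Λ.rng m → t l * t m = t (Λ.comp l m)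
  ck3 : ∀ l m, star (t l) * t m =
    setSum (Λ.minExt l m) fun p => t p.1 * star (t p.2)

/-- A Cuntz–Krieger `Λ`-family: relations (CK1)–(CK4). -/
structure IsCKFamily (t : Λ.Path → A) extends IsCK13 Λ t : Prop where
  ck4 : ∀ v E, Λ.IsVertex v → E ⊆ Λ.withRange v → E.Finite → Λ.Exhaustive v E →
    setProd E (fun l => t v - t l * star (t l)) = 0

/-- Condition (†) on a subset `F ⊆ Λ`. -/
def DaggerClosed (F : Set Λ.Path) : Prop :=
  ∀ l m σ τ a b, l ∈ F → m ∈ F → σ ∈ F → τ ∈ F →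
    Λ.deg l = Λ.deg m → Λ.deg σ = Λ.deg τ →
    Λ.src l = Λ.src m → Λ.src σ = Λ.src τ →
    (a, b) ∈ Λ.minExt m σ → Λ.comp l a ∈ F ∧ Λ.comp τ b ∈ F

/-- `ΠE`, the smallest subset of `Λ` containing `E` and satisfying (†). -/
def piSet (E : Set Λ.Path) : Set Λ.Path := ⋂₀ {F | E ⊆ F ∧ Λ.DaggerClosed F}

/-- For `P ⊆ Λ` and a path `l`, the set `{ν ∈ s(l)Λ : d(ν) > 0 and lν ∈ P}`;
with `P = ΠE` this is the set `T(l)`. -/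
def extInto (P : Set Λ.Path) (l : Λ.Path) : Set Λ.Path :=
  {ν | Λ.src l = Λ.rng ν ∧ Λ.deg ν ≠ 0 ∧ Λ.comp l ν ∈ P}

/-- The projection `Q(t)^{ΠE}_l`. -/
noncomputable def Qproj (t : Λ.Path → A) (E : Set Λ.Path) (l : Λ.Path) : A :=
  t l * star (t l) *
    setProd (Λ.extInto (Λ.piSet E) l)
      (fun ν => t l * star (t l) - t (Λ.comp l ν) * star (t (Λ.comp l ν)))

/-- The matrix unit `Θ(t,E;l,m) = Q(t)^{ΠE}_l t_l t_m^*`. -/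
noncomputable def Theta (t : Λ.Path → A) (E : Set Λ.Path) (l m : Λ.Path) : A :=
  Λ.Qproj t E l * (t l * star (t m))

end KGraph

/-- A degree-preserving functor `x : Ω_{k,m} → Λ` for some `m ∈ (ℕ ∪ {∞})^k`,
recorded by its degree `m` and its values `map p q` on the morphisms `(p,q)` of
`Ω_{k,m}` (normalised to the junk value `map 0 0` on pairs `(p,q)` that are not
morphisms of `Ω_{k,m}`). -/
structure OmegaMor {k : ℕ} (Λ : KGraph k) where
  m : Fin k → ℕ∞
  map : (Fin k → ℕ) → (Fin k → ℕ) → Λ.Path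
  deg_map : ∀ p q : Fin k → ℕ, p ≤ q → (∀ i, (q i : ℕ∞) ≤ m i) →
    Λ.deg (map p q) = q - p
  rng_map : ∀ p q : Fin k → ℕ, p ≤ q → (∀ i, (q i : ℕ∞) ≤ m i) →
    Λ.rng (map p q) = map p p
  src_map : ∀ p q : Fin k → ℕ, p ≤ q → (∀ i, (q i : ℕ∞) ≤ m i) →
    Λ.src (map p q) = map q q
  comp_map : ∀ p q r : Fin k → ℕ, p ≤ q → q ≤ r → (∀ i, (r i : ℕ∞) ≤ m i) →
    Λ.comp (map p q) (map q r) = map p r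
  map_default : ∀ p q : Fin k → ℕ, ¬(p ≤ q ∧ ∀ i, (q i : ℕ∞) ≤ m i) →
    map p q = map 0 0

/-- `x` is a boundary path: there is `n_x ≤ m` such that whenever `n_x ≤ n ≤ m`
and `n_i = m_i`, the vertex `x(n)` receives no edge of degree `e_i`. -/
def OmegaMor.IsBoundary {k : ℕ} {Λ : KGraph k} (x : OmegaMor Λ) : Prop :=
  ∃ nx : Fin k → ℕ, (∀ i, (nx i : ℕ∞) ≤ x.m i) ∧
    ∀ n : Fin k → ℕ, nx ≤ n → (∀ i, (n i : ℕ∞) ≤ x.m i) →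
      ∀ i : Fin k, (n i : ℕ∞) = x.m i →
        ¬∃ e, Λ.rng e = x.map n n ∧ Λ.deg e = Pi.single i 1


namespace KGraph

variable {k : ℕ} (Λ : KGraph k)

/-- A path of positive degree in direction `i` begins with an edge of degree `e_i`. -/
theorem exists_edge_of_deg_pos (a : Λ.Path) (i : Fin k) (h : 0 < Λ.deg a i) :
    ∃ e, Λ.rng e = Λ.rng a ∧ Λ.deg e = Pi.single i 1 := by
  have hle : Pi.single i 1 ≤ Λ.deg a := by
    intro j
    rcases eq_or_ne j i with rfl | hj
    · simpa using Nat.succ_le_of_lt h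
    · simp [hj]
  obtain ⟨p, ⟨hp, -, hsr, hcomp⟩, -⟩ :=
    Λ.factorisation a (Pi.single i 1) (Λ.deg a - Pi.single i 1)
      (add_tsub_cancel_of_le hle).symm
  exact ⟨p.1, by rw [← hcomp, Λ.rng_comp _ _ hsr], hp⟩

/-- A path `a` extending `l ∈ Λ^{≤ n}` to a path of degree at most `n` is the vertex `s(l)`. -/
theorem eq_src_of_mem_degLe {n : Fin k → ℕ} {l a : Λ.Path} (hl : l ∈ Λ.degLe n)
    (hs : Λ.src l = Λ.rng a) (hd : Λ.deg l + Λ.deg a ≤ n) : a = Λ.src l := by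
  have h0 : Λ.deg a = 0 := by
    funext i
    by_contra hne
    have hpos : 0 < Λ.deg a i := Nat.pos_of_ne_zero hne
    have hi : Λ.deg l i + Λ.deg a i ≤ n i := hd i
    exact hl.2 i (by omega) (hs ▸ Λ.exists_edge_of_deg_pos a i hpos)
  rw [hs, Λ.rng_eq_of_deg_zero a h0]

/-- Minimal common extensions of elements of `Λ^{≤ n}` are trivial. -/
theorem eq_of_mem_minExt_of_mem_degLe {n : Fin k → ℕ} {l m : Λ.Path} (hl : l ∈ Λ.degLe n)
    (hm : m ∈ Λ.degLe n) {p : Λ.Path × Λ.Path} (hp : p ∈ Λ.minExt l m) :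
    l = m ∧ p = (Λ.src l, Λ.src l) := by
  obtain ⟨h1, h2, hc, hd⟩ := hp
  have hle : Λ.deg l ⊔ Λ.deg m ≤ n := sup_le hl.1 hm.1
  have ha : p.1 = Λ.src l :=
    Λ.eq_src_of_mem_degLe hl h1 (by rw [← Λ.deg_comp _ _ h1, hd]; exact hle)
  have hb : p.2 = Λ.src m :=
    Λ.eq_src_of_mem_degLe hm h2 (by rw [← Λ.deg_comp _ _ h2, ← hc, hd]; exact hle)
  rw [ha, hb, Λ.comp_src_self, Λ.comp_src_self] at hc
  subst hc
  exact ⟨rfl, Prod.ext ha hb⟩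

theorem minExt_self_of_mem_degLe {n : Fin k → ℕ} {l : Λ.Path} (hl : l ∈ Λ.degLe n) :
    Λ.minExt l l = {(Λ.src l, Λ.src l)} := by
  refine Set.eq_singleton_iff_unique_mem.2
    ⟨?_, fun p hp => (Λ.eq_of_mem_minExt_of_mem_degLe hl hl hp).2⟩
  have hr : Λ.src l = Λ.rng (Λ.src l) := (Λ.rng_eq_of_deg_zero _ (Λ.deg_src l)).symm
  exact ⟨hr, hr, rfl, by simp [Λ.comp_src_self]⟩

theorem minExt_eq_empty_of_mem_degLe {n : Fin k → ℕ} {l m : Λ.Path} (hl : l ∈ Λ.degLe n)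
    (hm : m ∈ Λ.degLe n) (hne : l ≠ m) : Λ.minExt l m = ∅ :=
  Set.eq_empty_of_forall_notMem fun _ hp =>
    hne (Λ.eq_of_mem_minExt_of_mem_degLe hl hm hp).1

end KGraph

open Classical in
/-- for `l, m ∈ Λ^{≤ n}`, `t_l^* t_m = δ_{l,m} t_{s(l)}`. -/
theorem stmt1 {k : ℕ} (Λ : KGraph k) (hΛ : Λ.FinitelyAligned)
    {A : Type*} [CStarAlgebra A] (t : Λ.Path → A) (ht : Λ.IsCK13 t)
    (n : Fin k → ℕ) (l m : Λ.Path) (hl : l ∈ Λ.degLe n) (hm : m ∈ Λ.degLe n) :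
    star (t l) * t m = if l = m then t (Λ.src l) else 0 := by
  rw [ht.ck3]
  split_ifs with h
  · subst h
    obtain ⟨hstar, hidem⟩ := ht.vertex_projection _ (Λ.deg_src l)
    simp [Λ.minExt_self_of_mem_degLe hl, setSum, hstar, hidem]
  · simp [Λ.minExt_eq_empty_of_mem_degLe hl hm h, setSum]
end

section
/- Let (Λ,d) be a k-graph. Then for every vertex v of Λ there exists a boundary path x of Λ with r(x) = v; that is, vΛ^{≤∞} is nonempty for every vertex v. -/
open scoped BigOperators

namespace KGraph

variable {k : ℕ} {Λ : KGraph k}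

theorem rng_src (l : Λ.Path) : Λ.rng (Λ.src l) = Λ.src l :=
  Λ.rng_eq_of_deg_zero _ (Λ.deg_src l)

theorem src_rng (l : Λ.Path) : Λ.src (Λ.rng l) = Λ.rng l :=
  Λ.src_eq_of_deg_zero _ (Λ.deg_rng l)

/-- Factorisations with prescribed degree of the first factor are unique. -/
theorem comp_inj {a b a' b' : Λ.Path} (h : Λ.src a = Λ.rng b) (h' : Λ.src a' = Λ.rng b')
    (hc : Λ.comp a b = Λ.comp a' b') (hd : Λ.deg a = Λ.deg a') : a = a' ∧ b = b' := by
  have hdeg := Λ.deg_comp a b h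
  have hdb : Λ.deg b' = Λ.deg b := by
    have h2 := Λ.deg_comp a' b' h'
    rw [← hc, hdeg, hd] at h2
    exact (add_left_cancel h2).symm
  have := (Λ.factorisation _ _ _ hdeg).unique (y₁ := (a, b)) (y₂ := (a', b'))
    ⟨rfl, rfl, h, rfl⟩ ⟨hd.symm, hdb, h', hc.symm⟩
  exact Prod.ext_iff.mp this

theorem exists_comp_eq {l : Λ.Path} {n : Fin k → ℕ} (hn : n ≤ Λ.deg l) :
    ∃ a b, Λ.deg a = n ∧ Λ.deg a + Λ.deg b = Λ.deg l ∧ Λ.src a = Λ.rng b ∧ Λ.comp a b = l := by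
  obtain ⟨⟨a, b⟩, ⟨ha, -, hs, hc⟩, -⟩ :=
    Λ.factorisation l n (Λ.deg l - n) (add_tsub_cancel_of_le hn).symm
  exact ⟨a, b, ha, by rw [← hc, Λ.deg_comp a b hs], hs, hc⟩

/-- The vertex `w` receives an edge of degree `e_i`. -/
def ReceivesEdge (Λ : KGraph k) (w : Λ.Path) (i : Fin k) : Prop :=
  ∃ e, Λ.rng e = w ∧ Λ.deg e = Pi.single i 1

theorem ReceivesEdge.rng_of_src {m : Λ.Path} {i : Fin k} (h : Λ.ReceivesEdge (Λ.src m) i) :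
    Λ.ReceivesEdge (Λ.rng m) i := by
  obtain ⟨e, he, hd⟩ := h
  have hn : Pi.single i 1 ≤ Λ.deg (Λ.comp m e) := by
    rw [Λ.deg_comp _ _ he.symm, hd]
    exact le_add_self
  obtain ⟨a, b, ha, -, hs, hc⟩ := exists_comp_eq hn
  exact ⟨a, by rw [← Λ.rng_comp a b hs, hc, Λ.rng_comp m e he.symm], ha⟩

/-- Every path extends by a path whose source receives no edge in any direction
in which the extension has degree zero. -/
theorem exists_saturated (l : Λ.Path) :
    ∃ m, Λ.src l = Λ.rng m ∧ ∀ i, Λ.deg m i = 0 → ¬Λ.ReceivesEdge (Λ.src m) i := by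
  classical
  let z (m : Λ.Path) : ℕ := (Finset.univ.filter fun i => Λ.deg m i = 0).card
  obtain ⟨m, hm, hmin⟩ := exists_minimal_of_wellFoundedLT
    (fun c => ∃ m, Λ.src l = Λ.rng m ∧ z m = c) ⟨_, Λ.src l, (rng_src l).symm, rfl⟩
  obtain ⟨m, hm, rfl⟩ := hm
  refine ⟨m, hm, ?_⟩
  rintro i hi ⟨e, he, hd⟩
  have hdeg := Λ.deg_comp m e he.symm
  have hlt : z (Λ.comp m e) < z m := by
    refine Finset.card_lt_card (Finset.ssubset_iff_of_subset ?_ |>.mpr ⟨i, ?_, ?_⟩)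
    · intro j
      simp only [Finset.mem_filter, Finset.mem_univ, true_and, hdeg, Pi.add_apply]
      omega
    · simpa using hi
    · simp [hdeg, hd]
  have hle := hmin ⟨Λ.comp m e, by rw [Λ.rng_comp m e he.symm, hm], rfl⟩ hlt.le
  omega

/-- `m` is the segment `l(p,q)` of the path `l`. -/
def IsSegment (Λ : KGraph k) (l : Λ.Path) (p q : Fin k → ℕ) (m : Λ.Path) : Prop :=
  ∃ a c, Λ.deg a = p ∧ Λ.deg a + Λ.deg m = q ∧ Λ.src a = Λ.rng m ∧ Λ.src m = Λ.rng c ∧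
    Λ.comp (Λ.comp a m) c = l

theorem exists_isSegment {l : Λ.Path} {p q : Fin k → ℕ} (hpq : p ≤ q) (hq : q ≤ Λ.deg l) :
    ∃ m, Λ.IsSegment l p q m := by
  obtain ⟨b, c, rfl, -, hbc, rfl⟩ := exists_comp_eq hq
  obtain ⟨a, m, rfl, hd, ham, rfl⟩ := exists_comp_eq hpq
  exact ⟨m, a, c, rfl, hd, ham, by rwa [Λ.src_comp a m ham] at hbc, rfl⟩

namespace IsSegment

variable {l m m' : Λ.Path} {p q r : Fin k → ℕ}

theorem unique (h : Λ.IsSegment l p q m) (h' : Λ.IsSegment l p q m') : m = m' := by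
  obtain ⟨a, c, rfl, rfl, h1, h2, rfl⟩ := h
  obtain ⟨a', c', hd, hd', h1', h2', hc⟩ := h'
  have := comp_inj (by rwa [Λ.src_comp a' m' h1']) (by rwa [Λ.src_comp a m h1]) hc
    (by rw [Λ.deg_comp _ _ h1, Λ.deg_comp _ _ h1', hd'])
  exact ((comp_inj h1' h1 this.1 hd).2).symm

theorem deg_eq (h : Λ.IsSegment l p q m) : Λ.deg m = q - p := by
  obtain ⟨a, c, rfl, rfl, -⟩ := h
  rw [add_tsub_cancel_left]

theorem comp (h : Λ.IsSegment l p q m) {n : Λ.Path} (hn : Λ.src l = Λ.rng n) :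
    Λ.IsSegment (Λ.comp l n) p q m := by
  obtain ⟨a, c, hp, hq, h1, h2, rfl⟩ := h
  have h3 : Λ.src (Λ.comp a m) = Λ.rng c := by rwa [Λ.src_comp a m h1]
  rw [Λ.src_comp _ _ h3] at hn
  exact ⟨a, Λ.comp c n, hp, hq, h1, by rwa [Λ.rng_comp c n hn],
    (Λ.comp_assoc _ _ _ h3 hn).symm⟩

theorem rng (h : Λ.IsSegment l p q m) : Λ.IsSegment l p p (Λ.rng m) := by
  obtain ⟨a, c, rfl, -, h1, h2, rfl⟩ := h
  refine ⟨a, Λ.comp m c, rfl, by rw [Λ.deg_rng, add_zero], by rw [rng_eq_of_deg_zero _ _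
    (Λ.deg_rng m), h1], by rw [src_rng, Λ.rng_comp m c h2], ?_⟩
  rw [← h1, Λ.comp_src_self, Λ.comp_assoc a m c h1 h2]

theorem src (h : Λ.IsSegment l p q m) : Λ.IsSegment l q q (Λ.src m) := by
  obtain ⟨a, c, -, rfl, h1, h2, rfl⟩ := h
  have hs := Λ.src_comp a m h1
  refine ⟨Λ.comp a m, c, Λ.deg_comp a m h1, by rw [Λ.deg_src, add_zero, Λ.deg_comp a m h1],
    by rw [hs, rng_src], by rw [Λ.src_eq_of_deg_zero _ (Λ.deg_src m), h2], ?_⟩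
  rw [← hs, Λ.comp_src_self]

theorem exists_split (h : Λ.IsSegment l p r m) (hpq : p ≤ q) (hqr : q ≤ r) :
    ∃ b c, Λ.IsSegment l p q b ∧ Λ.IsSegment l q r c ∧ Λ.comp b c = m := by
  obtain ⟨a, d, rfl, rfl, h1, h2, rfl⟩ := h
  obtain ⟨b, c, hb, hbc, h3, rfl⟩ := exists_comp_eq (tsub_le_iff_left.mpr hqr)
  rw [Λ.src_comp b c h3] at h2
  rw [Λ.rng_comp b c h3] at h1
  have hab : Λ.deg a + Λ.deg b = q := by rw [hb, add_tsub_cancel_of_le hpq]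
  have hs := Λ.src_comp a b h1
  have hassoc := Λ.comp_assoc a b c h1 h3
  refine ⟨b, c, ⟨a, Λ.comp c d, rfl, hab, h1, by rwa [Λ.rng_comp c d h2], ?_⟩,
    ⟨Λ.comp a b, d, by rw [Λ.deg_comp a b h1, hab], ?_, by rwa [hs], h2, by rw [hassoc]⟩, rfl⟩
  · rw [← hassoc, Λ.comp_assoc _ c d (by rwa [hs]) h2]
  · rw [Λ.deg_comp a b h1, add_assoc, hbc]

end IsSegment

theorem isSegment_src (l : Λ.Path) : Λ.IsSegment l (Λ.deg l) (Λ.deg l) (Λ.src l) :=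
  ⟨l, Λ.src l, rfl, by rw [Λ.deg_src, add_zero], (rng_src l).symm,
    by rw [rng_src, Λ.src_eq_of_deg_zero _ (Λ.deg_src l)], by simp only [Λ.comp_src_self]⟩

section Chain

variable {s g : ℕ → Λ.Path}

theorem IsSegment.of_le (hg : ∀ n, Λ.src (s n) = Λ.rng (g n))
    (hs : ∀ n, s (n + 1) = Λ.comp (s n) (g n)) {p q : Fin k → ℕ} {m : Λ.Path} {n n' : ℕ}
    (h : Λ.IsSegment (s n) p q m) (hn : n ≤ n') : Λ.IsSegment (s n') p q m := by
  induction n', hn using Nat.le_induction with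
  | base => exact h
  | succ n' _ ih => exact hs n' ▸ ih.comp (hg n')

theorem deg_chain_mono (hg : ∀ n, Λ.src (s n) = Λ.rng (g n))
    (hs : ∀ n, s (n + 1) = Λ.comp (s n) (g n)) : Monotone fun n => Λ.deg (s n) :=
  monotone_nat_of_le_succ fun n => by
    rw [hs, Λ.deg_comp _ _ (hg n)]
    exact le_self_add

theorem exists_le_deg_chain (hg : ∀ n, Λ.src (s n) = Λ.rng (g n))
    (hs : ∀ n, s (n + 1) = Λ.comp (s n) (g n)) {q : Fin k → ℕ}
    (hq : ∀ i, (q i : ℕ∞) ≤ ⨆ n, (Λ.deg (s n) i : ℕ∞)) : ∃ n, q ≤ Λ.deg (s n) := by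
  have h (i : Fin k) : ∃ n, q i ≤ Λ.deg (s n) i := by
    rcases h0 : q i with _ | t
    · exact ⟨0, Nat.zero_le _⟩
    · have hlt : (t : ℕ∞) < ⨆ n, (Λ.deg (s n) i : ℕ∞) :=
        lt_of_lt_of_le (by rw [h0]; exact_mod_cast t.lt_succ_self) (hq i)
      obtain ⟨n, hn⟩ := lt_iSup_iff.mp hlt
      exact ⟨n, by exact_mod_cast hn⟩
  choose N hN using h
  exact ⟨Finset.univ.sup N, fun i => (hN i).trans
    (deg_chain_mono hg hs (Finset.le_sup (Finset.mem_univ i)) i)⟩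

open Classical in
/-- The limit of an increasing chain of paths. -/
noncomputable def chainLimit (hg : ∀ n, Λ.src (s n) = Λ.rng (g n))
    (hs : ∀ n, s (n + 1) = Λ.comp (s n) (g n)) : OmegaMor Λ :=
  have hex {p q : Fin k → ℕ} (h : p ≤ q ∧ ∀ i, (q i : ℕ∞) ≤ ⨆ n, (Λ.deg (s n) i : ℕ∞)) :
      ∃ m n, Λ.IsSegment (s n) p q m :=
    have ⟨n, hn⟩ := exists_le_deg_chain hg hs h.2
    have ⟨m, hm⟩ := exists_isSegment h.1 hn
    ⟨m, n, hm⟩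
  let x (p q : Fin k → ℕ) : Λ.Path :=
    if h : p ≤ q ∧ ∀ i, (q i : ℕ∞) ≤ ⨆ n, (Λ.deg (s n) i : ℕ∞) then (hex h).choose
    else (hex (p := 0) (q := 0) ⟨le_rfl, fun _ => zero_le⟩).choose
  have hx {p q : Fin k → ℕ} (h : p ≤ q) (hq : ∀ i, (q i : ℕ∞) ≤ ⨆ n, (Λ.deg (s n) i : ℕ∞)) :
      ∃ n, Λ.IsSegment (s n) p q (x p q) := by
    simp only [x, dif_pos (And.intro h hq)]
    exact (hex ⟨h, hq⟩).choose_spec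
  have huniq {p q : Fin k → ℕ} {m m' : Λ.Path} {n n' : ℕ} (h : Λ.IsSegment (s n) p q m)
      (h' : Λ.IsSegment (s n') p q m') : m = m' :=
    (h.of_le hg hs (le_max_left n n')).unique (h'.of_le hg hs (le_max_right n n'))
  { m := fun i => ⨆ n, (Λ.deg (s n) i : ℕ∞)
    map := x
    deg_map := fun p q hpq hq => (hx hpq hq).choose_spec.deg_eq
    rng_map := fun p q hpq hq =>
      have hp := fun i => (Nat.cast_le.mpr (hpq i)).trans (hq i)
      huniq (hx hpq hq).choose_spec.rng (hx le_rfl hp).choose_spec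
    src_map := fun p q hpq hq =>
      huniq (hx hpq hq).choose_spec.src (hx le_rfl hq).choose_spec
    comp_map := fun p q r hpq hqr hr => by
      have hq := fun i => (Nat.cast_le.mpr (hqr i)).trans (hr i)
      obtain ⟨n, hn⟩ := hx (hpq.trans hqr) hr
      obtain ⟨b, c, hb, hc, hbc⟩ := hn.exists_split hpq hqr
      rw [← hbc, huniq hb (hx hpq hq).choose_spec, huniq hc (hx hqr hr).choose_spec]
    map_default := fun p q h => by
      simp only [x, dif_neg h]
      rw [dif_pos ⟨le_rfl, fun _ => zero_le⟩] }

theorem isSegment_chainLimit (hg : ∀ n, Λ.src (s n) = Λ.rng (g n))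
    (hs : ∀ n, s (n + 1) = Λ.comp (s n) (g n)) {p q : Fin k → ℕ} {m : Λ.Path} {n : ℕ}
    (hpq : p ≤ q) (hq : ∀ i, (q i : ℕ∞) ≤ ⨆ n, (Λ.deg (s n) i : ℕ∞))
    (h : Λ.IsSegment (s n) p q m) : (chainLimit hg hs).map p q = m := by
  simp only [chainLimit, dif_pos (And.intro hpq hq)]
  generalize_proofs hex
  obtain ⟨n', hn'⟩ := hex.choose_spec
  exact (hn'.of_le hg hs (le_max_left n' n)).unique (h.of_le hg hs (le_max_right n' n))

theorem isBoundary_chainLimit (hg : ∀ n, Λ.src (s n) = Λ.rng (g n))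
    (hs : ∀ n, s (n + 1) = Λ.comp (s n) (g n))
    (hsat : ∀ n i, Λ.deg (g n) i = 0 → ¬Λ.ReceivesEdge (Λ.src (g n)) i) :
    (chainLimit hg hs).IsBoundary := by
  have hsucc (n : ℕ) : Λ.src (s (n + 1)) = Λ.src (g n) := by rw [hs, Λ.src_comp _ _ (hg n)]
  have hle (n : ℕ) (i : Fin k) : (Λ.deg (s n) i : ℕ∞) ≤ ⨆ n, (Λ.deg (s n) i : ℕ∞) :=
    le_iSup (fun n => (Λ.deg (s n) i : ℕ∞)) n
  have hanti {n n' : ℕ} {i : Fin k} (hn : n ≤ n')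
      (h : Λ.ReceivesEdge (Λ.src (s n')) i) : Λ.ReceivesEdge (Λ.src (s n)) i := by
    induction n', hn using Nat.le_induction with
    | base => exact h
    | succ n' _ ih =>
      rw [hsucc] at h
      exact ih (hg n' ▸ h.rng_of_src)
  have hfin (i : Fin k) : ∃ N, ∀ t : ℕ, (t : ℕ∞) = ⨆ n, (Λ.deg (s n) i : ℕ∞) →
      ¬Λ.ReceivesEdge (Λ.src (s N)) i := by
    by_cases htop : ∃ t : ℕ, (t : ℕ∞) = ⨆ n, (Λ.deg (s n) i : ℕ∞)
    · obtain ⟨t, ht⟩ := htop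
      obtain ⟨n, hn⟩ := exists_le_deg_chain hg hs (q := Pi.single i t) fun j => by
        obtain rfl | hj := eq_or_ne j i
        · simp [ht]
        · simp [hj]
      refine ⟨n + 1, fun _ _ => hsucc n ▸ hsat n i ?_⟩
      have h1 : Λ.deg (s (n + 1)) i ≤ t := by exact_mod_cast ht ▸ hle (n + 1) i
      have h2 : t ≤ Λ.deg (s n) i := by simpa using hn i
      rw [hs, Λ.deg_comp _ _ (hg n), Pi.add_apply] at h1
      omega
    · exact ⟨0, fun t ht => absurd ⟨t, ht⟩ htop⟩
  choose N hN using hfin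
  set M := Finset.univ.sup N
  refine ⟨Λ.deg (s M), hle M, fun n hn hnm i hi hedge => ?_⟩
  have hsrc := (chainLimit hg hs).src_map _ n hn hnm
  have hrng := (chainLimit hg hs).rng_map _ n hn hnm
  rw [isSegment_chainLimit hg hs le_rfl (hle M) (isSegment_src (s M))] at hrng
  rw [← hsrc] at hedge
  have h := ReceivesEdge.rng_of_src hedge
  rw [hrng] at h
  exact hN i (n i) hi (hanti (Finset.le_sup (Finset.mem_univ i)) h)

end Chain

end KGraph

/-- every vertex of a `k`-graph is the range of some boundary path. -/
theorem stmt4 {k : ℕ} (Λ : KGraph k) (v : Λ.Path) (hv : Λ.IsVertex v) :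
    ∃ x : OmegaMor Λ, x.IsBoundary ∧ x.map 0 0 = v := by
  choose f hf hsat using KGraph.exists_saturated (Λ := Λ)
  let s (n : ℕ) : Λ.Path := Nat.rec v (fun _ l => Λ.comp l (f l)) n
  have hg (n : ℕ) : Λ.src (s n) = Λ.rng (f (s n)) := hf (s n)
  have hs (n : ℕ) : s (n + 1) = Λ.comp (s n) (f (s n)) := rfl
  refine ⟨KGraph.chainLimit hg hs, KGraph.isBoundary_chainLimit hg hs fun n => hsat (s n), ?_⟩
  have hseg := KGraph.isSegment_src v
  rw [Λ.src_eq_of_deg_zero v hv, show Λ.deg v = 0 from hv] at hseg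
  exact KGraph.isSegment_chainLimit (n := 0) hg hs le_rfl (fun _ => zero_le) hseg
end

section
/- Let (Λ,d) be a finitely aligned k-graph and let E ⊆ Λ be finite. Then there exists a finite subset F ⊆ Λ which contains E and satisfies condition (†). Moreover, for every finite F ⊆ Λ containing E and satisfying (†), and every family {t_λ : λ ∈ Λ} of partial isometries satisfying relations (CK1)–(CK3), the linear span M^t_F := span{t_λ t_μ* : λ,μ ∈ F, d(λ) = d(μ)} is a finite-dimensional C*-subalgebra (it is closed under multiplication and adjoints). -/
open scoped BigOperators

namespace KGraph

section Paths

variable {k : ℕ} {Λ : KGraph k}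

theorem comp_eq_of_deg_eq_zero {l a : Λ.Path} (h : Λ.src l = Λ.rng a) (ha : Λ.deg a = 0) :
    Λ.comp l a = l := by
  rw [Λ.rng_eq_of_deg_zero a ha] at h
  rw [← h, Λ.comp_src_self]

/-- The factorisation property as a cancellation law. -/
theorem eq_of_comp_eq_comp {l m a b : Λ.Path} (hl : Λ.src l = Λ.rng a) (hm : Λ.src m = Λ.rng b)
    (hd : Λ.deg l = Λ.deg m) (h : Λ.comp l a = Λ.comp m b) : l = m ∧ a = b := by
  have hab : Λ.deg a = Λ.deg b := by
    have h' := congrArg Λ.deg h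
    rw [Λ.deg_comp _ _ hl, Λ.deg_comp _ _ hm, hd] at h'
    exact add_left_cancel h'
  have h' := (Λ.factorisation (Λ.comp l a) _ _ (Λ.deg_comp _ _ hl)).unique
    (y₁ := (l, a)) (y₂ := (m, b)) ⟨rfl, rfl, hl, rfl⟩ ⟨hd.symm, hab.symm, hm, h.symm⟩
  exact Prod.ext_iff.mp h'

theorem minExt_swap {l m a b : Λ.Path} (h : (a, b) ∈ Λ.minExt l m) : (b, a) ∈ Λ.minExt m l := by
  obtain ⟨h₁, h₂, h₃, h₄⟩ := h
  exact ⟨h₂, h₁, h₃.symm, by simpa only [← h₃, sup_comm] using h₄⟩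

/-- Every common extension factors through a minimal common extension. -/
theorem exists_minExt_of_comp_eq_comp {l m a b : Λ.Path} (hl : Λ.src l = Λ.rng a)
    (hm : Λ.src m = Λ.rng b) (h : Λ.comp l a = Λ.comp m b) :
    ∃ c d g, (c, d) ∈ Λ.minExt l m ∧ Λ.src c = Λ.rng g ∧ Λ.src d = Λ.rng g ∧
      Λ.comp c g = a ∧ Λ.comp d g = b := by
  have hda := Λ.deg_comp _ _ hl
  have hdb := Λ.deg_comp _ _ hm
  have hdab : Λ.deg l + Λ.deg a = Λ.deg m + Λ.deg b := by rw [← hda, ← hdb, h]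
  obtain ⟨⟨c, g⟩, ⟨hc, hg, hcg, hcomp⟩, -⟩ := Λ.factorisation a
    (Λ.deg l ⊔ Λ.deg m - Λ.deg l) (Λ.deg l + Λ.deg a - Λ.deg l ⊔ Λ.deg m) (by
      funext i
      have := congrFun hdab i
      simp only [Pi.add_apply, Pi.sub_apply, Pi.sup_apply] at *
      omega)
  obtain ⟨⟨d, g'⟩, ⟨hd, hg', hdg', hcomp'⟩, -⟩ := Λ.factorisation b
    (Λ.deg l ⊔ Λ.deg m - Λ.deg m) (Λ.deg l + Λ.deg a - Λ.deg l ⊔ Λ.deg m) (by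
      funext i
      have := congrFun hdab i
      simp only [Pi.add_apply, Pi.sub_apply, Pi.sup_apply] at *
      omega)
  dsimp only at hc hg hcg hcomp hd hg' hdg' hcomp'
  have hlc : Λ.src l = Λ.rng c := by rw [hl, ← hcomp, Λ.rng_comp _ _ hcg]
  have hmd : Λ.src m = Λ.rng d := by rw [hm, ← hcomp', Λ.rng_comp _ _ hdg']
  have hdc : Λ.deg (Λ.comp l c) = Λ.deg l ⊔ Λ.deg m := by
    rw [Λ.deg_comp _ _ hlc, hc]
    exact add_tsub_cancel_of_le le_sup_left
  have hdd : Λ.deg (Λ.comp m d) = Λ.deg l ⊔ Λ.deg m := by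
    rw [Λ.deg_comp _ _ hmd, hd]
    exact add_tsub_cancel_of_le le_sup_right
  obtain ⟨hξ, rfl⟩ := eq_of_comp_eq_comp (l := Λ.comp l c) (a := g) (m := Λ.comp m d) (b := g')
    (by rw [Λ.src_comp _ _ hlc, hcg]) (by rw [Λ.src_comp _ _ hmd, hdg']) (hdc.trans hdd.symm)
    (by rw [Λ.comp_assoc _ _ _ hlc hcg, Λ.comp_assoc _ _ _ hmd hdg', hcomp, hcomp', h])
  exact ⟨c, d, g, ⟨hlc, hmd, hξ, hdc⟩, hcg, hdg', hcomp, hcomp'⟩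

variable (Λ) in
/-- The total length of a path, that is, the sum of the coordinates of its degree. -/
def length (l : Λ.Path) : ℕ := ∑ i, Λ.deg l i

theorem length_eq_of_deg_eq {l m : Λ.Path} (h : Λ.deg l = Λ.deg m) :
    Λ.length l = Λ.length m := by
  rw [length, length, h]

theorem length_comp {l m : Λ.Path} (h : Λ.src l = Λ.rng m) :
    Λ.length (Λ.comp l m) = Λ.length l + Λ.length m := by
  simp only [length, Λ.deg_comp _ _ h, Pi.add_apply, Finset.sum_add_distrib]

theorem deg_eq_zero_of_length_eq_zero {l : Λ.Path} (h : Λ.length l = 0) : Λ.deg l = 0 := by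
  funext i
  exact Finset.sum_eq_zero_iff.mp h i (Finset.mem_univ i)

variable (Λ) in
/-- The closure of a set of paths under condition (†). -/
inductive DaggerClosure (E : Set Λ.Path) : Λ.Path → Prop
  | base {l : Λ.Path} : l ∈ E → DaggerClosure E l
  | step {l m σ a b : Λ.Path} : DaggerClosure E l → DaggerClosure E m → DaggerClosure E σ →
      Λ.deg l = Λ.deg m → Λ.src l = Λ.src m → (a, b) ∈ Λ.minExt m σ →
      DaggerClosure E (Λ.comp l a)

theorem daggerClosed_daggerClosure (E : Set Λ.Path) :
    Λ.DaggerClosed {l | Λ.DaggerClosure E l} := by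
  intro l m σ τ a b hl hm hσ hτ hdl hdσ hsl hsσ h
  exact ⟨DaggerClosure.step hl hm hσ hdl hsl h,
    DaggerClosure.step hτ hσ hm hdσ.symm hsσ.symm (minExt_swap h)⟩

theorem DaggerClosure.deg_le {E : Set Λ.Path} {N : Fin k → ℕ} (hN : ∀ l ∈ E, Λ.deg l ≤ N)
    {l : Λ.Path} (hl : Λ.DaggerClosure E l) : Λ.deg l ≤ N := by
  induction hl with
  | base h => exact hN _ h
  | step _ _ _ hd hs h _ ihm ihσ =>
    obtain ⟨h₁, -, -, h₄⟩ := h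
    rw [Λ.deg_comp _ _ (hs.trans h₁), hd, ← Λ.deg_comp _ _ h₁, h₄]
    exact sup_le ihm ihσ

variable (Λ) in
/-- The paths `la` with `l ∈ T` for which `a` completes some `m ∈ T` to a minimal common
extension with some element of `T`. -/
def minExtComp (T : Set Λ.Path) : Set Λ.Path :=
  {x | ∃ l ∈ T, ∃ m ∈ T, ∃ σ ∈ T, ∃ p ∈ Λ.minExt m σ, Λ.comp l p.1 = x}

variable (Λ) in
/-- The paths obtained from those of `A` by replacing an initial segment in `T` with another
path in `T` of the same degree and source. -/
def headReplace (T A : Set Λ.Path) : Set Λ.Path :=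
  {x | ∃ l ∈ T, ∃ m ∈ T, ∃ a, Λ.deg l = Λ.deg m ∧ Λ.src l = Λ.src m ∧ Λ.src m = Λ.rng a ∧
    Λ.comp m a ∈ A ∧ Λ.comp l a = x}

theorem FinitelyAligned.finite_minExtComp (hΛ : Λ.FinitelyAligned) {T : Set Λ.Path}
    (hT : T.Finite) : (Λ.minExtComp T).Finite := by
  have : Λ.minExtComp T ⊆
      ⋃ l ∈ T, ⋃ m ∈ T, ⋃ σ ∈ T, (fun p => Λ.comp l p.1) '' Λ.minExt m σ := by
    rintro x ⟨l, hl, m, hm, σ, hσ, p, hp, rfl⟩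
    simp only [Set.mem_iUnion]
    exact ⟨l, hl, m, hm, σ, hσ, p, hp, rfl⟩
  exact (hT.biUnion fun l _ => hT.biUnion fun m _ => hT.biUnion fun σ _ =>
    (hΛ m σ).image _).subset this

theorem finite_headReplace {T A : Set Λ.Path} (hT : T.Finite) (hA : A.Finite) :
    (Λ.headReplace T A).Finite := by
  have hfin (m : Λ.Path) : {a | Λ.src m = Λ.rng a ∧ Λ.comp m a ∈ A}.Finite := by
    refine Set.Finite.of_finite_image (f := Λ.comp m) (hA.subset ?_) ?_
    · rintro _ ⟨a, ha, rfl⟩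
      exact ha.2
    · intro a ha b hb hab
      exact (eq_of_comp_eq_comp ha.1 hb.1 rfl hab).2
  have : Λ.headReplace T A ⊆
      ⋃ l ∈ T, ⋃ m ∈ T, Λ.comp l '' {a | Λ.src m = Λ.rng a ∧ Λ.comp m a ∈ A} := by
    rintro x ⟨l, hl, m, hm, a, -, -, hs, ha, rfl⟩
    simp only [Set.mem_iUnion]
    exact ⟨l, hl, m, hm, a, ⟨hs, ha⟩, rfl⟩
  exact (hT.biUnion fun l _ => hT.biUnion fun m _ => (hfin m).image _).subset this

/-- An element of the closure of length `L` is, up to a single replacement of an initial segment,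
either a generator or a minimal common extension of strictly shorter elements. -/
theorem DaggerClosure.mem_headReplace {E T : Set Λ.Path} {L : ℕ}
    (hT : T = {l | Λ.DaggerClosure E l ∧ Λ.length l < L}) {x : Λ.Path}
    (hx : Λ.DaggerClosure E x) (hL : Λ.length x = L) :
    x ∈ (E ∪ Λ.minExtComp T) ∪ Λ.headReplace T (E ∪ Λ.minExtComp T) := by
  induction hx with
  | base h => exact Or.inl (Or.inl h)
  | @step l m σ a b hl hm hσ hd hs h ihl _ ihσ =>
    obtain ⟨h₁, h₂, h₃, h₄⟩ := id h
    dsimp only at h₁ h₂ h₃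
    have hla : Λ.src l = Λ.rng a := hs.trans h₁
    have hlen := length_comp hla
    have hlm := length_eq_of_deg_eq hd
    have hlenm := length_comp h₁
    have hlenσ := length_comp h₂
    rw [← h₃] at hlenσ
    by_cases hlL : Λ.length l = L
    · have ha := comp_eq_of_deg_eq_zero hla (deg_eq_zero_of_length_eq_zero (by omega))
      rw [ha]
      exact ihl hlL
    have hlT : l ∈ T := by rw [hT]; exact ⟨hl, by omega⟩
    have hmT : m ∈ T := by rw [hT]; exact ⟨hm, by omega⟩
    by_cases hσL : Λ.length σ < L
    · have hσT : σ ∈ T := by rw [hT]; exact ⟨hσ, hσL⟩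
      exact Or.inl (Or.inr ⟨l, hlT, m, hmT, σ, hσT, (a, b), h, rfl⟩)
    have hb := comp_eq_of_deg_eq_zero h₂ (deg_eq_zero_of_length_eq_zero (by omega))
    rw [hb] at h₃
    rcases ihσ (by omega) with hA | ⟨l', hl', m', hm', a', hd', hs', hma', hA, hσ'⟩
    · exact Or.inr ⟨l, hlT, m, hmT, a, hd, hs, h₁, h₃ ▸ hA, rfl⟩
    have hl'' := hl'
    have hm'' := hm'
    rw [hT] at hl'' hm''
    obtain ⟨c, e, g, hmin, hcg, heg, rfl, rfl⟩ :=
      exists_minExt_of_comp_eq_comp h₁ (hs'.trans hma') (h₃.trans hσ'.symm)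
    obtain ⟨k₁, k₂, k₃, k₄⟩ := id hmin
    dsimp only at k₁ k₂ k₃
    have hlc : Λ.src l = Λ.rng c := hs.trans k₁
    have hme : Λ.src m' = Λ.rng e := hs'.symm.trans k₂
    have hlenc := length_comp hlc
    have hlene := length_comp hme
    have hleng := length_comp hcg
    have hdce : Λ.deg (Λ.comp l c) = Λ.deg (Λ.comp m' e) := by
      rw [Λ.deg_comp _ _ hlc, Λ.deg_comp _ _ hme, hd, ← hd', ← Λ.deg_comp _ _ k₁,
        ← Λ.deg_comp _ _ k₂, k₃]
    have hlence := length_eq_of_deg_eq hdce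
    by_cases hg : Λ.length g = 0
    · rw [comp_eq_of_deg_eq_zero hcg (deg_eq_zero_of_length_eq_zero hg)]
      exact Or.inl (Or.inr ⟨l, hlT, m, hmT, l', hl', (c, e), hmin, rfl⟩)
    · refine Or.inr ⟨Λ.comp l c, ?_, Λ.comp m' e, ?_, g, hdce, ?_, ?_, ?_, ?_⟩
      · rw [hT]
        exact ⟨.step hl hm hl''.1 hd hs hmin, by omega⟩
      · rw [hT]
        exact ⟨.step hm''.1 hl''.1 hm hd'.symm hs'.symm (minExt_swap hmin), by omega⟩
      · rw [Λ.src_comp _ _ hlc, Λ.src_comp _ _ hme, hcg, heg]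
      · rw [Λ.src_comp _ _ hme, heg]
      · rwa [Λ.comp_assoc _ _ _ hme heg]
      · rw [Λ.comp_assoc _ _ _ hlc hcg]

theorem FinitelyAligned.finite_daggerClosure_length_lt (hΛ : Λ.FinitelyAligned) {E : Set Λ.Path}
    (hE : E.Finite) (L : ℕ) : {l | Λ.DaggerClosure E l ∧ Λ.length l < L}.Finite := by
  induction L with
  | zero => simp
  | succ L ih =>
    have hA := hE.union (hΛ.finite_minExtComp ih)
    refine (ih.union (hA.union (finite_headReplace ih hA))).subset ?_
    rintro x ⟨hx, hxL⟩
    rcases Nat.lt_succ_iff_lt_or_eq.mp hxL with h | h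
    · exact Or.inl ⟨hx, h⟩
    · exact Or.inr (hx.mem_headReplace rfl h)

theorem FinitelyAligned.finite_daggerClosure (hΛ : Λ.FinitelyAligned) {E : Set Λ.Path}
    (hE : E.Finite) : {l | Λ.DaggerClosure E l}.Finite := by
  obtain ⟨N, hN⟩ := (hE.image Λ.deg).bddAbove
  refine (hΛ.finite_daggerClosure_length_lt hE (∑ i, N i + 1)).subset fun l hl => ⟨hl, ?_⟩
  have := hl.deg_le fun m hm => hN ⟨m, hm, rfl⟩
  exact Nat.lt_succ_of_le (Finset.sum_le_sum fun i _ => this i)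

end Paths

section Families

variable {k : ℕ} {Λ : KGraph k} {A : Type*}

theorem IsCK13.mul_star_eq_zero [Ring A] [StarRing A] {t : Λ.Path → A} (ht : Λ.IsCK13 t)
    {l m : Λ.Path} (h : Λ.src l ≠ Λ.src m) : t l * star (t m) = 0 := by
  have hsrc (n : Λ.Path) : t n = t n * t (Λ.src n) := by
    rw [ht.comp_mul _ _ (rng_src n).symm, Λ.comp_src_self]
  rw [hsrc l, hsrc m, star_mul, (ht.vertex_projection _ (Λ.deg_src m)).1, mul_assoc,
    ← mul_assoc (t (Λ.src l)), ht.vertex_orthogonal _ _ (Λ.deg_src l) (Λ.deg_src m) h,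
    zero_mul, mul_zero]

theorem IsCK13.mul_mem_span [Ring A] [StarRing A] [Algebra ℂ A] {t : Λ.Path → A}
    (ht : Λ.IsCK13 t) {F : Set Λ.Path} (hF : Λ.DaggerClosed F) {l m σ τ : Λ.Path}
    (hl : l ∈ F) (hm : m ∈ F) (hσ : σ ∈ F) (hτ : τ ∈ F) (hd : Λ.deg l = Λ.deg m)
    (hd' : Λ.deg σ = Λ.deg τ) :
    t l * star (t m) * (t σ * star (t τ)) ∈ Submodule.span ℂ
      {a : A | ∃ l ∈ F, ∃ m ∈ F, Λ.deg l = Λ.deg m ∧ a = t l * star (t m)} := by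
  by_cases hs : Λ.src l = Λ.src m
  swap
  · rw [ht.mul_star_eq_zero hs, zero_mul]
    exact zero_mem _
  by_cases hs' : Λ.src σ = Λ.src τ
  swap
  · rw [ht.mul_star_eq_zero hs', mul_zero]
    exact zero_mem _
  rw [mul_assoc, ← mul_assoc (star (t m)), ht.ck3, setSum]
  split_ifs with hfin
  · rw [Finset.sum_mul, Finset.mul_sum]
    refine Submodule.sum_mem _ fun p hp => Submodule.subset_span ?_
    have hp := hfin.mem_toFinset.mp hp
    obtain ⟨h₁, h₂, h₃, -⟩ := id hp
    obtain ⟨hla, hτb⟩ := hF l m σ τ p.1 p.2 hl hm hσ hτ hd hd' hs hs' hp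
    refine ⟨_, hla, _, hτb, ?_, ?_⟩
    · rw [Λ.deg_comp _ _ (hs.trans h₁), Λ.deg_comp _ _ (hs'.symm.trans h₂), hd, ← hd',
        ← Λ.deg_comp _ _ h₁, ← Λ.deg_comp _ _ h₂, h₃]
    · rw [← ht.comp_mul _ _ (hs.trans h₁), ← ht.comp_mul _ _ (hs'.symm.trans h₂), star_mul]
      simp only [mul_assoc]
  · rw [zero_mul, mul_zero]
    exact zero_mem _

end Families

end KGraph

/-- there is a finite set `F ⊇ E` satisfying (†); and for any such `F`
and any family satisfying (CK1)–(CK3), `M^t_F = span{t_l t_m^* : l,m ∈ F, d(l)=d(m)}`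
is a finite-dimensional C*-subalgebra (closed under multiplication and adjoints). -/
theorem stmt6 {k : ℕ} (Λ : KGraph k) (hΛ : Λ.FinitelyAligned)
    (E : Set Λ.Path) (hE : E.Finite) {A : Type*} [CStarAlgebra A] :
    (∃ F : Set Λ.Path, F.Finite ∧ E ⊆ F ∧ Λ.DaggerClosed F) ∧
    (∀ F : Set Λ.Path, F.Finite → E ⊆ F → Λ.DaggerClosed F →
      ∀ t : Λ.Path → A, Λ.IsCK13 t →
        (∀ x ∈ Submodule.span ℂ
            {a : A | ∃ l ∈ F, ∃ m ∈ F, Λ.deg l = Λ.deg m ∧ a = t l * star (t m)},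
          ∀ y ∈ Submodule.span ℂ
            {a : A | ∃ l ∈ F, ∃ m ∈ F, Λ.deg l = Λ.deg m ∧ a = t l * star (t m)},
          x * y ∈ Submodule.span ℂ
            {a : A | ∃ l ∈ F, ∃ m ∈ F, Λ.deg l = Λ.deg m ∧ a = t l * star (t m)}) ∧
        (∀ x ∈ Submodule.span ℂ
            {a : A | ∃ l ∈ F, ∃ m ∈ F, Λ.deg l = Λ.deg m ∧ a = t l * star (t m)},
          star x ∈ Submodule.span ℂ
            {a : A | ∃ l ∈ F, ∃ m ∈ F, Λ.deg l = Λ.deg m ∧ a = t l * star (t m)}) ∧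
        FiniteDimensional ℂ (Submodule.span ℂ
          {a : A | ∃ l ∈ F, ∃ m ∈ F, Λ.deg l = Λ.deg m ∧ a = t l * star (t m)})) := by
  refine ⟨⟨{l | Λ.DaggerClosure E l}, hΛ.finite_daggerClosure hE, fun l hl => .base hl,
    KGraph.daggerClosed_daggerClosure E⟩, fun F hF _ hdag t ht => ⟨?_, ?_, ?_⟩⟩
  · intro x hx y hy
    induction hx, hy using Submodule.span_induction₂ with
    | mem_mem x y hx hy =>
      obtain ⟨l, hl, m, hm, hd, rfl⟩ := hx
      obtain ⟨σ, hσ, τ, hτ, hd', rfl⟩ := hy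
      exact ht.mul_mem_span hdag hl hm hσ hτ hd hd'
    | zero_left y _ => simp
    | zero_right x _ => simp
    | add_left x y z _ _ _ h h' => rw [add_mul]; exact add_mem h h'
    | add_right x y z _ _ _ h h' => rw [mul_add]; exact add_mem h h'
    | smul_left r x y _ _ h => rw [smul_mul_assoc]; exact Submodule.smul_mem _ r h
    | smul_right r x y _ _ h => rw [mul_smul_comm]; exact Submodule.smul_mem _ r h
  · intro x hx
    induction hx using Submodule.span_induction with
    | mem x hx =>
      obtain ⟨l, hl, m, hm, hd, rfl⟩ := hx
      exact Submodule.subset_span ⟨m, hm, l, hl, hd.symm, by rw [star_mul, star_star]⟩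
    | zero => simp
    | add x y _ _ h h' => rw [star_add]; exact add_mem h h'
    | smul r x _ h => rw [star_smul]; exact Submodule.smul_mem _ _ h
  · refine FiniteDimensional.span_of_finite ℂ ((hF.image2 (fun l m => t l * star (t m)) hF).subset ?_)
    rintro _ ⟨l, hl, m, hm, -, rfl⟩
    exact ⟨l, hl, m, hm, rfl⟩
end

section
/- Let (Λ,d) be a finitely aligned k-graph, E ⊆ Λ finite, and {t_λ : λ ∈ Λ} a Cuntz–Krieger Λ-family. Then for all λ,μ ∈ ΠE with d(λ) = d(μ) and s(λ) = s(μ): Θ(t,E;λ,μ) = t_λ (∏_{ν : d(ν)>0, λν ∈ ΠE} (t_{s(λ)} − t_ν t_ν*)) t_μ* = t_λ t_μ* Q(t)^{ΠE}_μ. -/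
open scoped BigOperators

theorem setProd_semiconjBy {ι A : Type*} [Monoid A] {S : Set ι} {f g : ι → A} {a : A}
    (h : ∀ i ∈ S, SemiconjBy a (f i) (g i)) :
    SemiconjBy a (setProd S f) (setProd S g) := by
  unfold setProd
  split_ifs with hS
  · have hmem : ∀ i ∈ hS.toFinset.toList, SemiconjBy a (f i) (g i) := fun i hi =>
      h i (by simpa using hi)
    generalize hS.toFinset.toList = L at hmem
    induction L with
    | nil => simp
    | cons i L ih =>
      simp only [List.map_cons, List.prod_cons]
      exact (hmem i (by simp)).mul_right (ih fun j hj => hmem j (by simp [hj]))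
  · exact SemiconjBy.one_right a

namespace KGraph

variable {k : ℕ} {Λ : KGraph k}

theorem daggerClosed_piSet (E : Set Λ.Path) : Λ.DaggerClosed (Λ.piSet E) := by
  intro l m σ τ a b hl hm hσ hτ h₁ h₂ h₃ h₄ hab
  refine ⟨fun F hF => ?_, fun F hF => ?_⟩
  · exact (hF.2 l m σ τ a b (hl F hF) (hm F hF) (hσ F hF) (hτ F hF) h₁ h₂ h₃ h₄ hab).1
  · exact (hF.2 l m σ τ a b (hl F hF) (hm F hF) (hσ F hF) (hτ F hF) h₁ h₂ h₃ h₄ hab).2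

theorem DaggerClosed.extInto_subset {F : Set Λ.Path} (hF : Λ.DaggerClosed F) {l m : Λ.Path}
    (hl : l ∈ F) (hm : m ∈ F) (hdeg : Λ.deg l = Λ.deg m) (hsrc : Λ.src l = Λ.src m) :
    Λ.extInto F l ⊆ Λ.extInto F m := by
  rintro ν ⟨h₁, h₂, h₃⟩
  refine ⟨hsrc ▸ h₁, h₂, ?_⟩
  refine (hF (Λ.comp l ν) (Λ.comp l ν) l m (Λ.src (Λ.comp l ν)) ν h₃ h₃ hl hm rfl hdeg rfl
    hsrc ⟨?_, h₁, Λ.comp_src_self _, ?_⟩).2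
  · exact (Λ.rng_eq_of_deg_zero _ (Λ.deg_src _)).symm
  · rw [Λ.comp_src_self, Λ.deg_comp _ _ h₁]
    exact (sup_eq_left.mpr le_self_add).symm

theorem minExt_self (l : Λ.Path) : Λ.minExt l l = {(Λ.src l, Λ.src l)} := by
  have hrng : Λ.src l = Λ.rng (Λ.src l) := (Λ.rng_eq_of_deg_zero _ (Λ.deg_src l)).symm
  ext ⟨a, b⟩
  simp only [minExt, Set.mem_ofPred_eq, Set.mem_singleton_iff, Prod.mk.injEq, sup_idem]
  constructor
  · rintro ⟨ha, hb, hab, hd⟩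
    have hd' := hd
    rw [hab, Λ.deg_comp _ _ hb] at hd'
    rw [Λ.deg_comp _ _ ha] at hd
    exact ⟨(ha.trans (Λ.rng_eq_of_deg_zero a (by simpa using hd))).symm,
      (hb.trans (Λ.rng_eq_of_deg_zero b (by simpa using hd'))).symm⟩
  · rintro ⟨rfl, rfl⟩
    exact ⟨hrng, hrng, rfl, by rw [Λ.comp_src_self]⟩

namespace IsCK13

variable {A : Type*} [Ring A] [StarRing A] {t : Λ.Path → A}

theorem star_mul_self (ht : Λ.IsCK13 t) (l : Λ.Path) : star (t l) * t l = t (Λ.src l) := by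
  have hv := ht.vertex_projection (Λ.src l) (Λ.deg_src l)
  rw [ht.ck3, minExt_self, setSum, dif_pos (Set.finite_singleton _)]
  simp [hv.1, hv.2]

theorem mul_src (ht : Λ.IsCK13 t) (l : Λ.Path) : t l * t (Λ.src l) = t l := by
  rw [ht.comp_mul _ _ (Λ.rng_eq_of_deg_zero _ (Λ.deg_src l)).symm, Λ.comp_src_self]

theorem rng_mul (ht : Λ.IsCK13 t) (l : Λ.Path) : t (Λ.rng l) * t l = t l := by
  rw [ht.comp_mul _ _ (Λ.src_eq_of_deg_zero _ (Λ.deg_rng l)), Λ.rng_comp_self]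

theorem semiconjBy_sub (ht : Λ.IsCK13 t) {l ν : Λ.Path} (h : Λ.src l = Λ.rng ν) :
    SemiconjBy (t l) (t (Λ.src l) - t ν * star (t ν))
      (t l * star (t l) - t (Λ.comp l ν) * star (t (Λ.comp l ν))) := by
  have hν : star (t ν) * t (Λ.src l) = star (t ν) := by
    conv_lhs => rw [← (ht.vertex_projection _ (Λ.deg_src l)).1, ← star_mul, h, ht.rng_mul]
  rw [SemiconjBy, mul_sub, sub_mul, ht.mul_src, ht.partialIsometry, ← ht.comp_mul _ _ h,
    star_mul, mul_assoc (t l * t ν), mul_assoc (star (t ν)), ht.star_mul_self, hν, mul_assoc]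

theorem semiconjBy_star_sub (ht : Λ.IsCK13 t) {l ν : Λ.Path} (h : Λ.src l = Λ.rng ν) :
    SemiconjBy (star (t l)) (t l * star (t l) - t (Λ.comp l ν) * star (t (Λ.comp l ν)))
      (t (Λ.src l) - t ν * star (t ν)) := by
  have hs := congrArg star (ht.semiconjBy_sub h).eq
  simp only [star_mul, star_sub, star_star, (ht.vertex_projection _ (Λ.deg_src l)).1] at hs
  exact hs.symm

end IsCK13

end KGraph

/-- for `l,m ∈ ΠE` with `d(l)=d(m)` and `s(l)=s(m)`,
`Θ(t,E;l,m) = t_l (∏_{ν ∈ T(l)} (t_{s(l)} - t_ν t_ν^*)) t_m^* = t_l t_m^* Q(t)^{ΠE}_m`. -/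
theorem stmt9 {k : ℕ} (Λ : KGraph k) (hΛ : Λ.FinitelyAligned)
    (E : Set Λ.Path) (hE : E.Finite) {A : Type*} [CStarAlgebra A]
    (t : Λ.Path → A) (ht : Λ.IsCKFamily t)
    (l m : Λ.Path) (hl : l ∈ Λ.piSet E) (hm : m ∈ Λ.piSet E)
    (hdeg : Λ.deg l = Λ.deg m) (hsrc : Λ.src l = Λ.src m) :
    Λ.Theta t E l m =
      t l * setProd (Λ.extInto (Λ.piSet E) l)
        (fun ν => t (Λ.src l) - t ν * star (t ν)) * star (t m) ∧
    Λ.Theta t E l m = t l * star (t m) * Λ.Qproj t E m := by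
  have hck := ht.toIsCK13
  have hF := KGraph.daggerClosed_piSet E
  have hext : Λ.extInto (Λ.piSet E) l = Λ.extInto (Λ.piSet E) m :=
    (hF.extInto_subset hl hm hdeg hsrc).antisymm (hF.extInto_subset hm hl hdeg.symm hsrc.symm)
  have hL := setProd_semiconjBy fun ν (hν : ν ∈ Λ.extInto (Λ.piSet E) l) =>
    hck.semiconjBy_sub hν.1
  have hM := setProd_semiconjBy fun ν (hν : ν ∈ Λ.extInto (Λ.piSet E) m) =>
    hck.semiconjBy_star_sub hν.1
  have hstar : star (t m) * (t m * star (t m)) = star (t m) := by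
    simpa [mul_assoc] using congrArg star (hck.partialIsometry m)
  have hΘ : Λ.Theta t E l m =
      t l * setProd (Λ.extInto (Λ.piSet E) l)
        (fun ν => t (Λ.src l) - t ν * star (t ν)) * star (t m) := by
    rw [KGraph.Theta, KGraph.Qproj, ← mul_assoc, mul_assoc (t l * star (t l)), ← hL.eq,
      ← mul_assoc, hck.partialIsometry]
  refine ⟨hΘ, ?_⟩
  rw [hΘ, KGraph.Qproj, hext, hsrc, mul_assoc, ← hM.eq, ← mul_assoc, ← mul_assoc,
    mul_assoc (t l) (star (t m)) (t m * star (t m)), hstar]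
end
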